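/- Let φ be the rotation of ℝ³ about the z-axis by angle arccos(1/3) and ρ the rotation about the x-axis by angle arccos(1/3). If w is a nonempty reduced word of length k in the letters φ^{±1}, ρ^{±1} whose last (rightmost) letter is φ, then w applied to the vector (1, 0, 0) equals (a, b√2, c)/3^k for some integers a, b, c with 3 not dividing b. In particular, such a w is not the identity transformation. -/

import Mathlib

/-- The rotation of `ℝ³` about the `z`-axis by the angle `arccos (1/3)`. -/
noncomputable def phiMat : Matrix (Fin 3) (Fin 3) ℝ :=
  !![1/3, -(2*Real.sqrt 2)/3, 0;
     (2*Real.sqrt 2)/3, 1/3, 0;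
     0, 0, 1]

/-- The rotation of `ℝ³` about the `x`-axis by the angle `arccos (1/3)`. -/
noncomputable def rhoMat : Matrix (Fin 3) (Fin 3) ℝ :=
  !![1, 0, 0;
     0, 1/3, -(2*Real.sqrt 2)/3;
     0, (2*Real.sqrt 2)/3, 1/3]

/-- The matrix associated to a letter: `(false, false) ↦ φ`, `(false, true) ↦ φ⁻¹`,
`(true, false) ↦ ρ`, `(true, true) ↦ ρ⁻¹`. -/
noncomputable def letterMat : Bool × Bool → Matrix (Fin 3) (Fin 3) ℝ
  | (false, false) => phiMat
  | (false, true) => phiMat⁻¹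
  | (true, false) => rhoMat
  | (true, true) => rhoMat⁻¹

open Matrix

theorem phiMat_inv : phiMat⁻¹ =
    !![1/3, (2*Real.sqrt 2)/3, 0;
       -(2*Real.sqrt 2)/3, 1/3, 0;
       0, 0, 1] := by
  have h2 : Real.sqrt 2 * Real.sqrt 2 = 2 := Real.mul_self_sqrt zero_le_two
  refine Matrix.inv_eq_right_inv ?_
  ext i j
  fin_cases i <;> fin_cases j <;> simp [phiMat, Matrix.mul_apply, Fin.sum_univ_three] <;>
    linarith

theorem rhoMat_inv : rhoMat⁻¹ =
    !![1, 0, 0;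
       0, 1/3, (2*Real.sqrt 2)/3;
       0, -(2*Real.sqrt 2)/3, 1/3] := by
  have h2 : Real.sqrt 2 * Real.sqrt 2 = 2 := Real.mul_self_sqrt zero_le_two
  refine Matrix.inv_eq_right_inv ?_
  ext i j
  fin_cases i <;> fin_cases j <;> simp [rhoMat, Matrix.mul_apply, Fin.sum_univ_three] <;>
    linarith

/-- The action of three times a letter on vectors `(a, b√2, c)`, in the coordinates `a, b, c`. -/
def letterStep : Bool × Bool → ℤ × ℤ × ℤ → ℤ × ℤ × ℤ
  | (false, false), (a, b, c) => (a - 4 * b, 2 * a + b, 3 * c)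
  | (false, true), (a, b, c) => (a + 4 * b, -2 * a + b, 3 * c)
  | (true, false), (a, b, c) => (3 * a, b - 2 * c, 4 * b + c)
  | (true, true), (a, b, c) => (3 * a, b + 2 * c, -4 * b + c)

/-- The vector `(a, b√2, c)`. -/
noncomputable def sqrtTwoVec (v : ℤ × ℤ × ℤ) : Fin 3 → ℝ :=
  ![(v.1 : ℝ), (v.2.1 : ℝ) * Real.sqrt 2, (v.2.2 : ℝ)]

theorem letterMat_mulVec_sqrtTwoVec (x : Bool × Bool) (v : ℤ × ℤ × ℤ) :
    letterMat x *ᵥ sqrtTwoVec v = (3 : ℝ)⁻¹ • sqrtTwoVec (letterStep x v) := by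
  have h2 : Real.sqrt 2 ^ 2 = 2 := Real.sq_sqrt zero_le_two
  obtain ⟨a, b, c⟩ := v
  rcases x with ⟨_ | _, _ | _⟩ <;> simp only [letterMat, phiMat_inv, rhoMat_inv] <;>
    ext i <;> fin_cases i <;>
    simp [phiMat, rhoMat, sqrtTwoVec, letterStep, Matrix.mulVec, dotProduct,
      Fin.sum_univ_three] <;>
    first | ring1 | (ring_nf; rw [h2]; ring1)

/-- The residues modulo `3` of the coordinates `a, b, c` obtained from a reduced word
with the given leftmost letter. -/
def LetterInvariant : Bool × Bool → ℤ × ℤ × ℤ → Prop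
  | (false, false), (a, b, c) => ¬ 3 ∣ b ∧ 3 ∣ c ∧ 3 ∣ a + b
  | (false, true), (a, b, c) => ¬ 3 ∣ b ∧ 3 ∣ c ∧ 3 ∣ a - b
  | (true, false), (a, b, c) => ¬ 3 ∣ b ∧ 3 ∣ a ∧ 3 ∣ c - b
  | (true, true), (a, b, c) => ¬ 3 ∣ b ∧ 3 ∣ a ∧ 3 ∣ c + b

theorem LetterInvariant.not_dvd {x : Bool × Bool} {v : ℤ × ℤ × ℤ} (h : LetterInvariant x v) :
    ¬ 3 ∣ v.2.1 := by
  rcases x with ⟨_ | _, _ | _⟩ <;> exact h.1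

theorem LetterInvariant.letterStep {x y : Bool × Bool} {v : ℤ × ℤ × ℤ}
    (h : LetterInvariant y v) (hxy : x.1 ≠ y.1 ∨ x.2 = y.2) :
    LetterInvariant x (letterStep x v) := by
  obtain ⟨a, b, c⟩ := v
  rcases x with ⟨_ | _, _ | _⟩ <;> rcases y with ⟨_ | _, _ | _⟩ <;>
    simp only [LetterInvariant, _root_.letterStep] at h ⊢ <;>
    first | omega | simp at hxy

theorem exists_letterInvariant_mulVec (w : List (Bool × Bool)) (hw : w ≠ [])
    (hred : w.IsChain fun x y => x.1 ≠ y.1 ∨ x.2 = y.2)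
    (hlast : w.getLast hw = (false, false)) :
    ∃ v, LetterInvariant (w.head hw) v ∧
      (w.map letterMat).prod *ᵥ ![1, 0, 0] = ((3 : ℝ) ^ w.length)⁻¹ • sqrtTwoVec v := by
  induction w with
  | nil => exact absurd rfl hw
  | cons x l ih =>
    cases l with
    | nil =>
      obtain rfl : x = (false, false) := hlast
      refine ⟨letterStep (false, false) (1, 0, 0), by simp [LetterInvariant, letterStep], ?_⟩
      have h : ![1, 0, 0] = sqrtTwoVec (1, 0, 0) := by simp [sqrtTwoVec]
      simp [h, letterMat_mulVec_sqrtTwoVec]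
    | cons y t =>
      rw [List.isChain_cons_cons] at hred
      obtain ⟨v, hv, hprod⟩ := ih (List.cons_ne_nil y t) hred.2 (by simpa using hlast)
      refine ⟨letterStep x v, hv.letterStep hred.1, ?_⟩
      rw [List.map_cons, List.prod_cons, ← Matrix.mulVec_mulVec, hprod, Matrix.mulVec_smul,
        letterMat_mulVec_sqrtTwoVec, smul_smul, ← mul_inv, ← pow_succ, ← List.length_cons]

/-- **The key divisibility invariant for words in `φ, ρ`.** If `w` is a nonempty reduced
word of length `k` in the letters `φ^{±1}, ρ^{±1}` whose rightmost letter is `φ`, then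
`w ⬝ (1,0,0) = (a, b√2, c)/3ᵏ` with `a, b, c ∈ ℤ` and `3 ∤ b`; in particular `w` is not
the identity transformation. -/
theorem word_apply_e1 (w : List (Bool × Bool)) (hw : w ≠ [])
    (hred : w.Chain' fun x y => x.1 ≠ y.1 ∨ x.2 = y.2)
    (hlast : w.getLast hw = (false, false)) :
    (∃ a b c : ℤ, ¬ (3 : ℤ) ∣ b ∧
      Matrix.mulVec ((w.map letterMat).prod) ![1, 0, 0] =
        ((3 : ℝ) ^ w.length)⁻¹ • ![(a : ℝ), (b : ℝ) * Real.sqrt 2, (c : ℝ)]) ∧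
    (w.map letterMat).prod ≠ 1 := by
  obtain ⟨⟨a, b, c⟩, hv, hprod⟩ := exists_letterInvariant_mulVec w hw hred hlast
  have hb : ¬ (3 : ℤ) ∣ b := hv.not_dvd
  refine ⟨⟨a, b, c, hb, hprod⟩, fun h => hb ?_⟩
  have h1 := congrFun hprod 1
  simp [h, sqrtTwoVec] at h1
  simp [h1]
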